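/- Let d ≥ 1, n ∈ ℕ₊ and 𝗆 = (m_1,…,m_n) ∈ ℕ^n. If V : (ℝ^d)^n × (ℝ^d)^{m_1+…+m_n} → ℝ is continuous, translationally invariant, periodic-compatible and ‖V‖_{𝒱^{𝗆}} < ∞, then ‖V‖_{𝒱^{𝗆}} = (2π)^{−d} ∫_{([0,2π)^d)^n} [V](x_1,…,x_n) dx_1…dx_n. Consequently, for every permutation ω of {1,…,n}, the function 𝐘^ω V defined by 𝐘^ω V(x_1,…,x_n; 𝗒_1,…,𝗒_n) := V(x_{ω(1)},…,x_{ω(n)}; 𝗒_{ω(1)},…,𝗒_{ω(n)}) (with 𝗒_j ∈ (ℝ^d)^{m_{ω(j)}} in the j-th block of 𝐘^ω V) satisfies ‖𝐘^ω V‖_{𝒱^{ω(𝗆)}} ≤ ‖V‖_{𝒱^{𝗆}}, where ω(𝗆) = (m_{ω(1)},…,m_{ω(n)}). -/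

import Mathlib

open MeasureTheory ENNReal Real

/-- The box `[0,2π)^d`, a fundamental domain of the torus `𝕋 = ℝ^d/(2πℤ)^d`. -/
def box (d : ℕ) : Set (Fin d → ℝ) := Set.univ.pi fun _ => Set.Ico 0 (2 * π)

/-- The norm `‖V‖_{𝒱^𝗆} = sup_{x₁} ∫_{([0,2π)^d)^{n−1}} [V](x₁,…,x_n) dx₂…dx_n` for a
function of `n = q+1` variables in `ℝ^d` and a collection `y : Y` of further variables
(the y-variables are encoded as a single measure space `Y`, and
`[V](x) = ∫_Y |V(x;y)| dy`). -/
noncomputable def VnormG (d q : ℕ) {Y : Type} [MeasureSpace Y]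
    (V : (Fin (q + 1) → Fin d → ℝ) → Y → ℝ) : ℝ≥0∞ :=
  ⨆ x1 : Fin d → ℝ, ∫⁻ xr in (Set.univ.pi fun _ : Fin q => box d),
    ∫⁻ y : Y, (‖V (Fin.cons x1 xr) y‖₊ : ℝ≥0∞)

/-- Translation invariance: `V(x₁+z,…,x_n+z; y₁+z,…,y_m+z) = V(x;y)`. -/
def TransInv (d n M : ℕ) (V : (Fin n → Fin d → ℝ) → (Fin M → Fin d → ℝ) → ℝ) : Prop :=
  ∀ (x : Fin n → Fin d → ℝ) (y : Fin M → Fin d → ℝ) (z : Fin d → ℝ),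
    V (fun j => x j + z) (fun i => y i + z) = V x y

/-- Periodic compatibility with respect to a block assignment `b` (the y-variable `yᵢ`
belongs to the block of the x-variable `x_{b i}`): the function
`x ↦ V(x; y + x∘b)` is `2π`-periodic in each x-variable. -/
def PerCompat (d n M : ℕ) (b : Fin M → Fin n)
    (V : (Fin n → Fin d → ℝ) → (Fin M → Fin d → ℝ) → ℝ) : Prop :=
  ∀ (x : Fin n → Fin d → ℝ) (y : Fin M → Fin d → ℝ) (k : Fin n → Fin d → ℤ),
    V (fun j => x j + fun i => 2 * π * (k j i : ℝ))
      (fun i0 => y i0 + fun i => 2 * π * (k (b i0) i : ℝ)) = V x y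

/-- The lattice `(2πℤ)^d` in each of `n` variables of `ℝ^d`. -/
noncomputable def periodLattice (n d : ℕ) : AddSubgroup (Fin n → Fin d → ℝ) :=
  AddMonoidHom.range
    { toFun := fun (k : Fin n → Fin d → ℤ) j i => 2 * π * (k j i : ℝ)
      map_zero' := by ext; simp
      map_add' := fun k l => by ext; simp [mul_add] }

theorem mem_periodLattice {n d : ℕ} {v : Fin n → Fin d → ℝ} :
    v ∈ periodLattice n d ↔ ∃ k : Fin n → Fin d → ℤ, (fun j i => 2 * π * (k j i : ℝ)) = v :=
  Iff.rfl

instance countable_periodLattice (n d : ℕ) : Countable (periodLattice n d) := by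
  unfold periodLattice
  exact (AddMonoidHom.rangeRestrict_surjective _).countable

theorem measurableSet_box (d : ℕ) : MeasurableSet (box d) :=
  MeasurableSet.univ_pi fun _ => measurableSet_Ico

theorem measurableSet_pi_box (n d : ℕ) :
    MeasurableSet (Set.univ.pi fun _ : Fin n => box d) :=
  MeasurableSet.univ_pi fun _ => measurableSet_box d

theorem volume_box (d : ℕ) : volume (box d) = ENNReal.ofReal ((2 * π) ^ d) := by
  rw [box, volume_pi_pi]
  simp [Real.volume_Ico, ENNReal.ofReal_pow two_pi_pos.le]

theorem isAddFundamentalDomain_pi_box (n d : ℕ) :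
    IsAddFundamentalDomain (periodLattice n d) (Set.univ.pi fun _ : Fin n => box d) := by
  refine IsAddFundamentalDomain.mk' (measurableSet_pi_box n d).nullMeasurableSet fun x => ?_
  have h : ∀ j i, ∃! m : ℤ, x j i + m • (2 * π) ∈ Set.Ico 0 (0 + 2 * π) := fun j i =>
    existsUnique_add_zsmul_mem_Ico two_pi_pos (x j i) 0
  choose k hk hk' using h
  refine ⟨⟨_, mem_periodLattice.2 ⟨k, rfl⟩⟩, ?_, ?_⟩
  · intro j _ i _
    have := hk j i
    simp only [zsmul_eq_mul, zero_add] at this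
    simpa [AddSubgroup.vadd_def, add_comm, mul_comm] using this
  · rintro ⟨v, hv⟩ hx
    obtain ⟨l, rfl⟩ := mem_periodLattice.1 hv
    have hl : l = k := by
      ext j i
      refine hk' j i (l j i) ?_
      have := hx j trivial i trivial
      simpa [AddSubgroup.vadd_def, add_comm, mul_comm] using this
    subst hl
    rfl

open scoped Pointwise in
/-- Integrals of periodic functions over the box do not change under translations. -/
theorem setLIntegral_pi_box_add {n d : ℕ} (F : (Fin n → Fin d → ℝ) → ℝ≥0∞)
    (hF : ∀ (x : Fin n → Fin d → ℝ) (k : Fin n → Fin d → ℤ),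
      F (fun j => x j + fun i => 2 * π * (k j i : ℝ)) = F x)
    (a : Fin n → Fin d → ℝ) :
    ∫⁻ x in (Set.univ.pi fun _ : Fin n => box d), F (a + x) =
      ∫⁻ x in (Set.univ.pi fun _ : Fin n => box d), F x := by
  have hbox := isAddFundamentalDomain_pi_box n d
  have himage : ∫⁻ x in (Set.univ.pi fun _ : Fin n => box d), F (a + x) =
      ∫⁻ x in a +ᵥ (Set.univ.pi fun _ : Fin n => box d), F x :=
    (measurePreserving_add_left volume a).setLIntegral_comp_emb
      (measurableEmbedding_addLeft a) F _
  rw [himage]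
  refine (hbox.vadd_of_comm a).setLIntegral_eq hbox F ?_
  rintro ⟨v, hv⟩ x
  obtain ⟨k, rfl⟩ := mem_periodLattice.1 hv
  rw [← hF x k]
  congr 1
  ext j i
  simp [AddSubgroup.vadd_def, add_comm]

theorem setLIntegral_pi_box_succ {p d : ℕ} {W : (Fin (p + 1) → Fin d → ℝ) → ℝ≥0∞}
    (hW : Measurable W) :
    ∫⁻ x in (Set.univ.pi fun _ : Fin (p + 1) => box d), W x =
      ∫⁻ x1 in box d, ∫⁻ xr in (Set.univ.pi fun _ : Fin p => box d), W (Fin.cons x1 xr) := by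
  have he := (volume_preserving_piFinSuccAbove (fun _ : Fin (p + 1) => Fin d → ℝ) 0).symm
  have hpre : (MeasurableEquiv.piFinSuccAbove (fun _ : Fin (p + 1) => Fin d → ℝ) 0).symm ⁻¹'
      (Set.univ.pi fun _ : Fin (p + 1) => box d) =
      box d ×ˢ (Set.univ.pi fun _ : Fin p => box d) := by
    ext ⟨x1, xr⟩
    simp [MeasurableEquiv.piFinSuccAbove, Fin.forall_fin_succ]
  have hcomp := he.setLIntegral_comp_preimage_emb (MeasurableEquiv.measurableEmbedding _) W
    (Set.univ.pi fun _ : Fin (p + 1) => box d)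
  rw [← hcomp, hpre, Measure.volume_eq_prod, ← Measure.prod_restrict,
    lintegral_prod _ (by fun_prop)]
  simp [MeasurableEquiv.piFinSuccAbove, Fin.insertNthEquiv]

/-- For a translation invariant, periodic function, the supremum over the first variable of the
integral over the others is the average over the first variable. -/
theorem iSup_setLIntegral_cons_eq {p d : ℕ} {W : (Fin (p + 1) → Fin d → ℝ) → ℝ≥0∞}
    (hW : Measurable W)
    (hti : ∀ (x : Fin (p + 1) → Fin d → ℝ) (z : Fin d → ℝ), W (fun j => x j + z) = W x)
    (hper : ∀ (x : Fin (p + 1) → Fin d → ℝ) (k : Fin (p + 1) → Fin d → ℤ),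
      W (fun j => x j + fun i => 2 * π * (k j i : ℝ)) = W x) :
    ⨆ x1 : Fin d → ℝ, ∫⁻ xr in (Set.univ.pi fun _ : Fin p => box d), W (Fin.cons x1 xr) =
      (ENNReal.ofReal ((2 * π) ^ d))⁻¹ *
        ∫⁻ x in (Set.univ.pi fun _ : Fin (p + 1) => box d), W x := by
  have hconst : ∀ x1 : Fin d → ℝ,
      ∫⁻ xr in (Set.univ.pi fun _ : Fin p => box d), W (Fin.cons x1 xr) =
        ∫⁻ xr in (Set.univ.pi fun _ : Fin p => box d), W (Fin.cons 0 xr) := by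
    intro x1
    rw [← setLIntegral_pi_box_add (fun xr => W (Fin.cons 0 xr)) _ fun _ => -x1]
    · refine lintegral_congr fun xr => ?_
      rw [← hti (Fin.cons x1 xr) (-x1)]
      congr 1
      ext j i
      refine Fin.cases ?_ (fun j => ?_) j <;> simp [add_comm]
    · intro xr k
      rw [← hper (Fin.cons 0 xr) (Fin.cons 0 k)]
      congr 1
      ext j i
      refine Fin.cases ?_ (fun j => ?_) j <;> simp
  have hpos : ENNReal.ofReal ((2 * π) ^ d) ≠ 0 := by
    simpa using pow_pos two_pi_pos d
  simp_rw [setLIntegral_pi_box_succ hW, hconst]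
  rw [ciSup_const, setLIntegral_const, volume_box, mul_comm (lintegral _ _), ← mul_assoc,
    ENNReal.inv_mul_cancel hpos ofReal_ne_top, one_mul]

theorem setLIntegral_pi_box_comp_perm {n d : ℕ} (W : (Fin n → Fin d → ℝ) → ℝ≥0∞)
    (ω : Equiv.Perm (Fin n)) :
    ∫⁻ x in (Set.univ.pi fun _ : Fin n => box d), W (fun j => x (ω j)) =
      ∫⁻ x in (Set.univ.pi fun _ : Fin n => box d), W x := by
  have he := volume_measurePreserving_piCongrLeft (fun _ : Fin n => Fin d → ℝ) ω.symm
  have hfun : ∀ x : Fin n → Fin d → ℝ,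
      MeasurableEquiv.piCongrLeft (fun _ : Fin n => Fin d → ℝ) ω.symm x = fun j => x (ω j) := by
    intro x
    funext j
    simpa using MeasurableEquiv.piCongrLeft_apply_apply (β := fun _ : Fin n => Fin d → ℝ)
      ω.symm x (ω j)
  have hpre : MeasurableEquiv.piCongrLeft (fun _ : Fin n => Fin d → ℝ) ω.symm ⁻¹'
      (Set.univ.pi fun _ : Fin n => box d) = Set.univ.pi fun _ : Fin n => box d := by
    ext x
    simp only [Set.mem_preimage, hfun, Set.mem_univ_pi]
    exact ⟨fun h j => by simpa using h (ω.symm j), fun h j => h (ω j)⟩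
  have hcomp := he.setLIntegral_comp_preimage_emb (MeasurableEquiv.measurableEmbedding _) W
    (Set.univ.pi fun _ : Fin n => box d)
  rw [hpre] at hcomp
  simpa only [hfun] using hcomp

/-- for continuous, translationally invariant, periodic-compatible `V` with
finite norm, `‖V‖_{𝒱^𝗆} = (2π)^{−d} ∫_{([0,2π)^d)^n} [V]`, and consequently for every
permutation `ω` of the x-variables (together with their y-blocks),
`‖𝐘^ω V‖_{𝒱^{ω(𝗆)}} ≤ ‖V‖_{𝒱^𝗆}`. -/
theorem stmt3 (d p M : ℕ) (hd : 1 ≤ d) (b : Fin M → Fin (p + 1))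
    (V : (Fin (p + 1) → Fin d → ℝ) → (Fin M → Fin d → ℝ) → ℝ)
    (hcont : Continuous fun q : (Fin (p + 1) → Fin d → ℝ) × (Fin M → Fin d → ℝ) =>
      V q.1 q.2)
    (hti : TransInv d (p + 1) M V) (hpc : PerCompat d (p + 1) M b V)
    (hfin : VnormG d p V < ⊤) :
    (VnormG d p V = (ENNReal.ofReal ((2 * π) ^ d))⁻¹ *
      ∫⁻ x in (Set.univ.pi fun _ : Fin (p + 1) => box d),
        ∫⁻ y : Fin M → Fin d → ℝ, (‖V x y‖₊ : ℝ≥0∞)) ∧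
    ∀ ω : Equiv.Perm (Fin (p + 1)),
      VnormG d p (fun x y => V (fun j => x (ω j)) y) ≤ VnormG d p V := by
  set W : (Fin (p + 1) → Fin d → ℝ) → ℝ≥0∞ :=
    fun x => ∫⁻ y : Fin M → Fin d → ℝ, (‖V x y‖₊ : ℝ≥0∞) with hWdef
  have hW : Measurable W :=
    (hcont.measurable.nnnorm.coe_nnreal_ennreal).lintegral_prod_right'
  have hWti : ∀ (x : Fin (p + 1) → Fin d → ℝ) (z : Fin d → ℝ),
      W (fun j => x j + z) = W x := by
    intro x z
    simp only [hWdef]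
    rw [← lintegral_add_right_eq_self _ (fun _ => z)]
    exact lintegral_congr fun y => by rw [← hti x y z]; rfl
  have hWper : ∀ (x : Fin (p + 1) → Fin d → ℝ) (k : Fin (p + 1) → Fin d → ℤ),
      W (fun j => x j + fun i => 2 * π * (k j i : ℝ)) = W x := by
    intro x k
    simp only [hWdef]
    rw [← lintegral_add_right_eq_self _ (fun i0 i => 2 * π * (k (b i0) i : ℝ))]
    exact lintegral_congr fun y => by rw [← hpc x y k]; rfl
  have hV := iSup_setLIntegral_cons_eq hW hWti hWper
  refine ⟨hV, fun ω => le_of_eq ?_⟩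
  have hVω := iSup_setLIntegral_cons_eq (W := fun x => W (fun j => x (ω j)))
    (hW.comp (measurable_pi_lambda _ fun j => measurable_pi_apply (ω j)))
    (fun x z => hWti (fun j => x (ω j)) z)
    (fun x k => hWper (fun j => x (ω j)) (fun j => k (ω j)))
  rw [setLIntegral_pi_box_comp_perm, ← hV] at hVω
  exact hVω
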